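/- Let G be a (theta, prism)-free graph and let Σ be a pyramid in G with apex a, base {b1, b2, b3} and paths P1, P2, P3. Let u and v be vertices of G \ N[Z(Σ)] that belong to distinct paths of Σ. Then N[Z(Σ)] separates u and v in G. -/

import Mathlib

open SimpleGraph

namespace Paper

variable {V : Type}

/-- Two vertex sets are anticomplete: no edges between them. -/
def Anticomplete (G : SimpleGraph V) (A B : Set V) : Prop :=
  ∀ a ∈ A, ∀ b ∈ B, ¬ G.Adj a b

/-- A stable (independent) set of vertices. -/
def StableSet (G : SimpleGraph V) (A : Set V) : Prop :=
  ∀ x ∈ A, ∀ y ∈ A, x ≠ y → ¬ G.Adj x y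

/-- A walk is induced in `G`: any two adjacent vertices on it are consecutive. -/
def InducedWalk (G : SimpleGraph V) {u v : V} (P : G.Walk u v) : Prop :=
  ∀ x ∈ P.support, ∀ y ∈ P.support, G.Adj x y → s(x, y) ∈ P.edges

/-- The interior (set of internal vertices) of a walk from `u` to `v`. -/
def Interior {G : SimpleGraph V} {u v : V} (P : G.Walk u v) : Set V :=
  {w | w ∈ P.support ∧ w ≠ u ∧ w ≠ v}

/-- Closed neighborhood of a set of vertices. -/
def ClosedNbhd (G : SimpleGraph V) (A : Set V) : Set V :=
  A ∪ {v | ∃ a ∈ A, G.Adj v a}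

/-- Open neighborhood of a set of vertices. -/
def OpenNbhd (G : SimpleGraph V) (A : Set V) : Set V :=
  {v | v ∉ A ∧ ∃ a ∈ A, G.Adj v a}

/-- `M` separates `x` and `y` in `G`: there is a separation `(L, M, R)` with `x ∈ L`, `y ∈ R`. -/
def Separates (G : SimpleGraph V) (M : Set V) (x y : V) : Prop :=
  ∃ L R : Set V,
    L ∪ M ∪ R = Set.univ ∧
    Disjoint L M ∧ Disjoint L R ∧ Disjoint M R ∧
    L.Nonempty ∧ R.Nonempty ∧ Anticomplete G L R ∧ x ∈ L ∧ y ∈ R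

/-- `G` contains a theta as an induced subgraph. -/
def ContainsTheta (G : SimpleGraph V) : Prop :=
  ∃ (a b : V) (P₁ P₂ P₃ : G.Walk a b),
    a ≠ b ∧ ¬ G.Adj a b ∧
    P₁.IsPath ∧ P₂.IsPath ∧ P₃.IsPath ∧
    InducedWalk G P₁ ∧ InducedWalk G P₂ ∧ InducedWalk G P₃ ∧
    2 ≤ P₁.length ∧ 2 ≤ P₂.length ∧ 2 ≤ P₃.length ∧
    Disjoint (Interior P₁) (Interior P₂) ∧
    Disjoint (Interior P₁) (Interior P₃) ∧
    Disjoint (Interior P₂) (Interior P₃) ∧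
    Anticomplete G (Interior P₁) (Interior P₂) ∧
    Anticomplete G (Interior P₁) (Interior P₃) ∧
    Anticomplete G (Interior P₂) (Interior P₃)

/-- `G` contains a prism as an induced subgraph (one path may have length zero). -/
def ContainsPrism (G : SimpleGraph V) : Prop :=
  ∃ (a b : Fin 3 → V) (P : ∀ i, G.Walk (a i) (b i)),
    (∀ i j, i ≠ j → G.Adj (a i) (a j)) ∧
    (∀ i j, i ≠ j → G.Adj (b i) (b j)) ∧
    (∀ i, (P i).IsPath) ∧ (∀ i, InducedWalk G (P i)) ∧
    (∀ i j, i ≠ j → ∀ x, x ∈ (P i).support → x ∉ (P j).support) ∧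
    (∀ i j, i ≠ j → ∀ x ∈ (P i).support, ∀ y ∈ (P j).support,
        G.Adj x y → (x = a i ∧ y = a j) ∨ (x = b i ∧ y = b j)) ∧
    (∀ i j, i ≠ j → 2 ≤ (P i).length + (P j).length)

/-- `G` contains `K_{1,t}` as an induced subgraph. -/
def ContainsK1t (G : SimpleGraph V) (t : ℕ) : Prop :=
  ∃ (v : V) (S : Finset V),
    S.card = t ∧ v ∉ S ∧ (∀ x ∈ S, G.Adj v x) ∧ StableSet G ↑S

/-- `G` belongs to the class `C_t` of (theta, prism, `K_{1,t}`)-free graphs. -/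
def MemCt (t : ℕ) (G : SimpleGraph V) : Prop :=
  ¬ ContainsTheta G ∧ ¬ ContainsPrism G ∧ ¬ ContainsK1t G t

/-- A tree decomposition of `G`. -/
structure TreeDecomp (G : SimpleGraph V) where
  ι : Type
  T : SimpleGraph ι
  isTree : T.IsTree
  bag : ι → Set V
  mem_bag : ∀ v : V, ∃ i, v ∈ bag i
  edge_bag : ∀ u v : V, G.Adj u v → ∃ i, u ∈ bag i ∧ v ∈ bag i
  bag_connected : ∀ v : V, (T.induce {i | v ∈ bag i}).Connected

/-- The tree independence number of `G` is at most `k`. -/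
def TreeAlphaLE (G : SimpleGraph V) (k : ℕ) : Prop :=
  ∃ D : TreeDecomp G, ∀ i : D.ι, ∀ S : Finset V,
    ↑S ⊆ D.bag i → StableSet G ↑S → S.card ≤ k

/-- Sum of weights over a vertex set. -/
noncomputable def wSum [Fintype V] (w : V → ℝ) (A : Set V) : ℝ :=
  ∑ v, A.indicator w v

/-- `D` is a connected component of `G \ X`. -/
def IsComponentOf (G : SimpleGraph V) (X D : Set V) : Prop :=
  D.Nonempty ∧ D ⊆ Xᶜ ∧ (G.induce D).Connected ∧
  ∀ D' : Set V, D ⊆ D' → D' ⊆ Xᶜ → (G.induce D').Connected → D' = D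

/-- `X` is a `w`-balanced separator in `G`. -/
def BalancedSeparator [Fintype V] (G : SimpleGraph V) (w : V → ℝ) (X : Set V) : Prop :=
  ∀ D : Set V, IsComponentOf G X D → wSum w D ≤ 1 / 2

/-- A closed walk is a hole (induced cycle of length at least four) in `G`. -/
def IsHoleWalk (G : SimpleGraph V) {h : V} (H : G.Walk h h) : Prop :=
  H.IsCycle ∧ 4 ≤ H.length ∧ InducedWalk G H

/-- The neighbors of `c` on the hole `H`. -/
def HoleNbrs (G : SimpleGraph V) {h : V} (H : G.Walk h h) (c : V) : Set V :=
  {v | v ∈ H.support ∧ G.Adj c v}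

/-- `(H, c)` is a wheel in `G`. -/
def IsWheel (G : SimpleGraph V) {h : V} (H : G.Walk h h) (c : V) : Prop :=
  IsHoleWalk G H ∧ c ∉ H.support ∧ 3 ≤ (HoleNbrs G H c).ncard

/-- `P` is a sector of the wheel `(H, c)`. -/
def IsSector (G : SimpleGraph V) {h : V} (H : G.Walk h h) (c : V)
    {x y : V} (P : G.Walk x y) : Prop :=
  P.IsPath ∧ 0 < P.length ∧
  (∀ w ∈ P.support, w ∈ H.support) ∧
  (∀ e ∈ P.edges, e ∈ H.edges) ∧
  G.Adj c x ∧ G.Adj c y ∧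
  ∀ w ∈ P.support, w ≠ x → w ≠ y → ¬ G.Adj c w

/-- The wheel `(H, c)` is special. -/
def IsSpecialWheel (G : SimpleGraph V) {h : V} (H : G.Walk h h) (c : V) : Prop :=
  IsWheel G H c ∧ ∃ a b d : V,
    a ≠ b ∧ a ≠ d ∧ b ≠ d ∧
    HoleNbrs G H c = {a, b, d} ∧
    s(a, b) ∈ H.edges ∧ s(a, d) ∉ H.edges ∧ s(b, d) ∉ H.edges

/-- `Z(W)` for a non-special wheel `W = (H, c)`. -/
def ZNonSpecial (G : SimpleGraph V) {h : V} (H : G.Walk h h) (c : V) : Set V :=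
  {c} ∪ HoleNbrs G H c

/-- `Z(W)` for a special wheel `W = (H, c)` with length-one sector `ab` and third neighbor `d`. -/
def ZSpecial (G : SimpleGraph V) {h : V} (H : G.Walk h h) (c a b d : V) : Set V :=
  ({a, b, c, d} : Set V) ∪ {v | s(v, d) ∈ H.edges}

/-- A pyramid in `G` with apex `apx`, base `b 0, b 1, b 2` and paths `P i`. -/
def IsPyramid (G : SimpleGraph V) (apx : V) (b : Fin 3 → V)
    (P : ∀ i, G.Walk apx (b i)) : Prop :=
  (∀ i, b i ≠ apx) ∧
  (∀ i j, i ≠ j → G.Adj (b i) (b j)) ∧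
  (∀ i, (P i).IsPath) ∧ (∀ i, InducedWalk G (P i)) ∧
  (∀ i, 1 ≤ (P i).length) ∧
  (∀ i j, i ≠ j → ∀ x, x ∈ (P i).support → x ∈ (P j).support → x = apx) ∧
  (∀ i j, i ≠ j → ∀ x ∈ (P i).support, ∀ y ∈ (P j).support,
      x ≠ apx → y ≠ apx → G.Adj x y → x = b i ∧ y = b j) ∧
  (∀ i j, i ≠ j → 3 ≤ (P i).length + (P j).length)

/-- `Z(Σ)` for a pyramid. -/
def ZPyramid (G : SimpleGraph V) (apx : V) (b : Fin 3 → V)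
    (P : ∀ i, G.Walk apx (b i)) : Set V :=
  {apx} ∪ {v | (∃ i, v ∈ (P i).support) ∧ G.Adj apx v} ∪ Set.range b

/-- `x : Fin k → V` enumerates `X` in an order witnessing that `(P, X)` is an alignment. -/
def AlignmentOrder (G : SimpleGraph V) {p q : V} (P : G.Walk p q)
    (X : Finset V) {k : ℕ} (x : Fin k → V) : Prop :=
  Function.Injective x ∧ (∀ l, x l ∈ X) ∧ (∀ z ∈ X, ∃ l, x l = z) ∧
  ∃ lo hi : Fin k → ℕ,
    (∀ l, lo l ≤ hi l) ∧
    (∀ l m : Fin k, l < m → hi l < lo m) ∧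
    (∀ l, hi l < P.support.length) ∧
    ∀ (l : Fin k) (n : Fin P.support.length),
      G.Adj (x l) (P.support.get n) → lo l ≤ (n : ℕ) ∧ (n : ℕ) ≤ hi l

/-- `(P, X)` is an alignment. -/
def IsAlignment (G : SimpleGraph V) {p q : V} (P : G.Walk p q) (X : Finset V) : Prop :=
  (∀ z ∈ X, z ∉ P.support) ∧
  (∀ z ∈ X, ∃ u ∈ P.support, G.Adj z u) ∧
  ∃ (k : ℕ) (x : Fin k → V), AlignmentOrder G P X x

/-- Every vertex of `X` has two non-adjacent neighbors in `P`. -/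
def WideAl (G : SimpleGraph V) {p q : V} (P : G.Walk p q) (X : Finset V) : Prop :=
  ∀ z ∈ X, ∃ u v : V, u ∈ P.support ∧ v ∈ P.support ∧
    G.Adj z u ∧ G.Adj z v ∧ u ≠ v ∧ ¬ G.Adj u v

/-- Every vertex of `X` has a unique neighbor in `P`. -/
def SpikyAl (G : SimpleGraph V) {p q : V} (P : G.Walk p q) (X : Finset V) : Prop :=
  ∀ z ∈ X, ∃! u : V, u ∈ P.support ∧ G.Adj z u

/-- Every vertex of `X` has exactly two neighbors in `P`, and they are adjacent. -/
def TriangularAl (G : SimpleGraph V) {p q : V} (P : G.Walk p q) (X : Finset V) : Prop :=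
  ∀ z ∈ X, ∃ u v : V, u ∈ P.support ∧ v ∈ P.support ∧
    G.Adj z u ∧ G.Adj z v ∧ u ≠ v ∧ G.Adj u v ∧
    ∀ w ∈ P.support, G.Adj z w → w = u ∨ w = v

/-- `(P, X)` is a consistent alignment. -/
def ConsistentAlignment (G : SimpleGraph V) {p q : V} (P : G.Walk p q) (X : Finset V) : Prop :=
  IsAlignment G P X ∧ (WideAl G P X ∨ SpikyAl G P X ∨ TriangularAl G P X)

/-- A branch vertex of a graph: a vertex of degree at least three. -/
def BranchVtx {W : Type} (T : SimpleGraph W) (v : W) : Prop :=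
  3 ≤ (T.neighborSet v).ncard

/-- `T` is a caterpillar: a tree of maximum degree three, no two branch vertices adjacent,
and some path contains all branch vertices. -/
def IsCaterpillar {W : Type} (T : SimpleGraph W) : Prop :=
  T.IsTree ∧ (∀ v, (T.neighborSet v).ncard ≤ 3) ∧
  (∀ u v, BranchVtx T u → BranchVtx T v → ¬ T.Adj u v) ∧
  ∃ (x y : W) (P : T.Walk x y), P.IsPath ∧ ∀ v, BranchVtx T v → v ∈ P.support

/-- `T` is a subdivided star with root `r`. -/
def IsSubdividedStar {W : Type} (T : SimpleGraph W) (r : W) : Prop :=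
  T.IsTree ∧ 3 ≤ (T.neighborSet r).ncard ∧ ∀ v, v ≠ r → (T.neighborSet v).ncard ≤ 2

/-- `H` is isomorphic to the line graph of a caterpillar. -/
def IsLineCaterpillar {U : Type} (H : SimpleGraph U) : Prop :=
  ∃ (W : Type) (T : SimpleGraph W), IsCaterpillar T ∧ Nonempty (H ≃g T.lineGraph)

/-- `H` is isomorphic to the line graph of a subdivided star. -/
def IsLineSubdividedStar {U : Type} (H : SimpleGraph U) : Prop :=
  ∃ (W : Type) (T : SimpleGraph W) (r : W),
    IsSubdividedStar T r ∧ Nonempty (H ≃g T.lineGraph)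

/-- `v` is a simplicial vertex of `G[S]`. -/
def SimplicialIn (G : SimpleGraph V) (S : Set V) (v : V) : Prop :=
  v ∈ S ∧ ∀ u ∈ S, ∀ w ∈ S, G.Adj v u → G.Adj v w → u ≠ w → G.Adj u w

/-- `G[S]` is one of the four connectifier shapes. -/
def ConnType (G : SimpleGraph V) (S : Set V) : Prop :=
  IsCaterpillar (G.induce S) ∨ IsLineCaterpillar (G.induce S) ∨
  (∃ r, IsSubdividedStar (G.induce S) r) ∨ IsLineSubdividedStar (G.induce S)

/-- `(G[S], X)` is a connectifier. -/
def IsConnectifier (G : SimpleGraph V) (S : Set V) (X : Finset V) : Prop :=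
  (∀ z ∈ X, (z : V) ∉ S) ∧ (∀ z ∈ X, ∃ r ∈ S, G.Adj z r) ∧
  ( (∃ v, S = {v}) ∨
    ( ConnType G S ∧
      (∀ z ∈ X, ∀ r₁ ∈ S, ∀ r₂ ∈ S, G.Adj z r₁ → G.Adj z r₂ → r₁ = r₂) ∧
      (∀ z ∈ X, ∀ r ∈ S, G.Adj z r → SimplicialIn G S r) ∧
      (∀ v, SimplicialIn G S v → ∃ z ∈ X, G.Adj z v) ) )

/-- The connectifier `(G[S], X)` is concentrated. -/
def Concentrated (G : SimpleGraph V) (S : Set V) : Prop :=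
  (∃ v, S = {v}) ∨ (∃ r, IsSubdividedStar (G.induce S) r) ∨
  IsLineSubdividedStar (G.induce S)

/-- Reachability inside a vertex set `A`. -/
def Reaches (G : SimpleGraph V) (A : Set V) (u v : V) : Prop :=
  ∃ (w : G.Walk u v), ∀ z ∈ w.support, z ∈ A

/-- `Pw` is a spine of the caterpillar `G[S]`: a maximal path containing all branch vertices. -/
def IsSpineOf (G : SimpleGraph V) (S : Set V) {p q : V} (Pw : G.Walk p q) : Prop :=
  Pw.IsPath ∧ (∀ w ∈ Pw.support, w ∈ S) ∧
  (∀ v ∈ S, 3 ≤ ({u | u ∈ S ∧ G.Adj v u}).ncard → v ∈ Pw.support) ∧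
  ∀ (p' q' : V) (P' : G.Walk p' q'), P'.IsPath → (∀ w ∈ P'.support, w ∈ S) →
    (∀ w ∈ Pw.support, w ∈ P'.support) → ∀ w ∈ P'.support, w ∈ Pw.support

/-- `Pw` realizes `P(H)` for `H = G[S]`, when `H` is a caterpillar or the line graph
of a caterpillar. -/
def IsPHOf (G : SimpleGraph V) (S : Set V) {p q : V} (Pw : G.Walk p q) : Prop :=
  Pw.IsPath ∧ (∀ w ∈ Pw.support, w ∈ S) ∧
  ( (IsCaterpillar (G.induce S) ∧ IsSpineOf G S Pw) ∨
    (∃ (W : Type) (T : SimpleGraph W) (φ : T.lineGraph ≃g G.induce S)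
        (x y : W) (Q : T.Walk x y),
      IsCaterpillar T ∧ Q.IsPath ∧
      (∀ v, BranchVtx T v → v ∈ Q.support) ∧
      (∀ (x' y' : W) (Q' : T.Walk x' y'), Q'.IsPath →
        (∀ w ∈ Q.support, w ∈ Q'.support) → ∀ w ∈ Q'.support, w ∈ Q.support) ∧
      {w | w ∈ Pw.support} = {v : V | ∃ e : T.edgeSet, (e : Sym2 W) ∈ Q.edges ∧ ↑(φ e) = v}) )

/-- `x` enumerates `X` in the order given by the (non-concentrated) connectifier `(G[S], X)`
with central path `Pw = P(H)`. -/
def ConnectifierOrder (G : SimpleGraph V) (S : Set V) (X : Finset V)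
    {p q : V} (Pw : G.Walk p q) {k : ℕ} (x : Fin k → V) : Prop :=
  Function.Injective x ∧ (∀ l, x l ∈ X) ∧ (∀ z ∈ X, ∃ l, x l = z) ∧
  ∃ (s : Fin k → V) (lo hi : Fin k → ℕ),
    (∀ l, lo l ≤ hi l) ∧ (∀ l m : Fin k, l < m → hi l < lo m) ∧
    (∀ l, hi l < Pw.support.length) ∧
    (∀ (l : Fin k) (n : Fin Pw.support.length),
      G.Adj (s l) (Pw.support.get n) → lo l ≤ (n : ℕ) ∧ (n : ℕ) ≤ hi l) ∧
    ∀ l : Fin k, s l ∈ S ∧ s l ∉ Pw.support ∧ (∃ u ∈ Pw.support, G.Adj (s l) u) ∧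
      ∀ r ∈ S, G.Adj (x l) r → Reaches G (S \ {w | w ∈ Pw.support}) r (s l)

/-- `(G[S], X)` is a consistent alignment (with `G[S]` a path). -/
def ConsistentAlignmentSet (G : SimpleGraph V) (S : Set V) (X : Finset V) : Prop :=
  ∃ (p q : V) (Pw : G.Walk p q), Pw.IsPath ∧ InducedWalk G Pw ∧
    {w | w ∈ Pw.support} = S ∧ ConsistentAlignment G Pw X

/-- The orders on `X` given by `(D1, X)` and by `(G[S], X)` coincide. -/
def OrdersAgree (G : SimpleGraph V) {p q : V} (D1w : G.Walk p q)
    (S : Set V) (X : Finset V) : Prop :=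
  ∃ (k : ℕ) (x : Fin k → V),
    AlignmentOrder G D1w X x ∧
    ( (∃ (p' q' : V) (Pw : G.Walk p' q'), IsPHOf G S Pw ∧ ConnectifierOrder G S X Pw x) ∨
      (∃ (p' q' : V) (Pw : G.Walk p' q'), Pw.IsPath ∧ InducedWalk G Pw ∧
        {w | w ∈ Pw.support} = S ∧ AlignmentOrder G Pw X x) )

/-- `(D1, Y, D2)` is an `s`-trisection of `G`, where `D1` is (the support of) the path `D1w`. -/
def IsTrisection (G : SimpleGraph V) (s : ℕ) {p q : V} (D1w : G.Walk p q)
    (Y D2 : Set V) : Prop :=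
  D1w.IsPath ∧ InducedWalk G D1w ∧
  (∀ w ∈ D1w.support, w ∉ Y ∧ w ∉ D2) ∧ Disjoint Y D2 ∧
  ({w | w ∈ D1w.support} ∪ Y ∪ D2 = Set.univ) ∧
  D2.Nonempty ∧
  (∀ a ∈ D1w.support, ∀ b ∈ D2, ¬ G.Adj a b) ∧
  StableSet G Y ∧ Y.ncard = s ∧
  OpenNbhd G {w | w ∈ D1w.support} = Y ∧ OpenNbhd G D2 = Y ∧
  (∀ y ∈ Y, ∃ d ∈ D1w.support, ∀ z ∈ Y, (G.Adj d z ↔ z = y))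

/-- The conclusion of amiability for the trisection `(D1w, Y, D2)` with parameter `x`:
the pair `(G[S], X)` is "given by amiability". -/
def AmiableOutcome (G : SimpleGraph V) {p q : V} (D1w : G.Walk p q)
    (Y D2 : Set V) (x : ℕ) (S : Set V) (X : Finset V) : Prop :=
  S ⊆ D2 ∧ ↑X ⊆ Y ∧ X.card = x ∧
  ConsistentAlignment G D1w X ∧
  (IsConnectifier G S X ∨ ConsistentAlignmentSet G S X) ∧
  (¬ (IsConnectifier G S X ∧ Concentrated G S) → OrdersAgree G D1w S X)


namespace Reaches

variable {G : SimpleGraph V} {A B : Set V} {x y z : V}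

theorem refl (hx : x ∈ A) : Reaches G A x x :=
  ⟨.nil, by simpa using hx⟩

theorem symm (h : Reaches G A x y) : Reaches G A y x := by
  obtain ⟨w, hw⟩ := h
  exact ⟨w.reverse, by simpa using hw⟩

theorem trans (h : Reaches G A x y) (h' : Reaches G A y z) : Reaches G A x z := by
  obtain ⟨w, hw⟩ := h
  obtain ⟨w', hw'⟩ := h'
  refine ⟨w.append w', fun t ht => ?_⟩
  rcases Walk.mem_support_append_iff _ _ |>.1 ht with h | h
  exacts [hw t h, hw' t h]

theorem of_adj (hx : x ∈ A) (hy : y ∈ A) (h : G.Adj x y) : Reaches G A x y :=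
  ⟨.cons h .nil, by simp [hx, hy]⟩

theorem mono (h : Reaches G A x y) (hAB : A ⊆ B) : Reaches G B x y := by
  obtain ⟨w, hw⟩ := h
  exact ⟨w, fun t ht => hAB (hw t ht)⟩

theorem mem_left (h : Reaches G A x y) : x ∈ A := by
  obtain ⟨w, hw⟩ := h
  exact hw x w.start_mem_support

/-- Consecutive adjacent vertices of a sequence are joined inside any set containing them. -/
theorem of_seq {f : ℕ → V} {m n : ℕ} (hmn : m ≤ n)
    (hA : ∀ k, m ≤ k → k ≤ n → f k ∈ A)
    (hadj : ∀ k, m ≤ k → k < n → G.Adj (f k) (f (k + 1))) : Reaches G A (f m) (f n) := by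
  induction n, hmn using Nat.le_induction with
  | base => exact refl (hA m le_rfl le_rfl)
  | succ n hmn ih =>
    exact (ih (fun k h1 h2 => hA k h1 (by omega)) fun k h1 h2 => hadj k h1 (by omega)).trans
      (of_adj (hA n hmn (by omega)) (hA _ (by omega) le_rfl) (hadj n hmn (by omega)))

/-- A shortest walk inside a set is an induced path. -/
theorem exists_inducedWalk (h : Reaches G A x y) :
    ∃ w : G.Walk x y, w.IsPath ∧ InducedWalk G w ∧ ∀ t ∈ w.support, t ∈ A := by
  classical
  have hex : ∃ n, ∃ w : G.Walk x y, w.length = n ∧ ∀ t ∈ w.support, t ∈ A := by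
    obtain ⟨w, hw⟩ := h
    exact ⟨_, w, rfl, hw⟩
  obtain ⟨w, hlen, hw⟩ := Nat.find_spec hex
  have hmin (w' : G.Walk x y) (hw' : ∀ t ∈ w'.support, t ∈ A) : w.length ≤ w'.length :=
    hlen ▸ Nat.find_min' hex ⟨w', rfl, hw'⟩
  refine ⟨w, ?_, ?_, hw⟩
  · rw [← w.bypass_eq_self_of_length_le_length_bypass
      (hmin _ fun t ht => hw t (w.support_bypass_subset_support ht))]
    exact w.bypass_isPath
  · have key (m n : ℕ) (hmn : m < n) (hn : n ≤ w.length)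
        (hadj : G.Adj (w.getVert m) (w.getVert n)) : s(w.getVert m, w.getVert n) ∈ w.edges := by
      have hle := hmin ((w.take m).append (.cons hadj (w.drop n))) fun t ht => hw t <| by
        rcases Walk.mem_support_append_iff _ _ |>.1 ht with h | h
        · obtain ⟨k, rfl, -⟩ := Walk.mem_support_iff_exists_getVert.1 h
          rw [Walk.take_getVert]
          exact w.getVert_mem_support _
        · rw [Walk.support_cons, List.mem_cons] at h
          rcases h with rfl | h
          · exact w.getVert_mem_support _
          · obtain ⟨k, rfl, -⟩ := Walk.mem_support_iff_exists_getVert.1 h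
            rw [Walk.drop_getVert]
            exact w.getVert_mem_support _
      simp only [Walk.length_append, Walk.length_cons, Walk.take_length, Walk.drop_length] at hle
      obtain rfl : n = m + 1 := by omega
      exact (w.mk_mem_edges_iff_exists).2 ⟨m, by omega, rfl⟩
    intro s hs t ht hadj
    obtain ⟨m, rfl, hm⟩ := Walk.mem_support_iff_exists_getVert.1 hs
    obtain ⟨n, rfl, hn⟩ := Walk.mem_support_iff_exists_getVert.1 ht
    rcases lt_trichotomy m n with hlt | rfl | hlt
    · exact key m n hlt hn hadj
    · exact absurd hadj G.irrefl
    · rw [Sym2.eq_swap]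
      exact key n m hlt hm hadj.symm

end Reaches

theorem two_le_length_of_not_adj {G : SimpleGraph V} {x y : V} (hne : x ≠ y) (h : ¬ G.Adj x y)
    (w : G.Walk x y) : 2 ≤ w.length := by
  by_contra! hlt
  have : w.length = 0 ∨ w.length = 1 := by omega
  rcases this with h0 | h1
  · exact hne (Walk.eq_of_length_eq_zero h0)
  · exact h (Walk.adj_of_length_eq_one h1)

/-- Three pairwise disjoint and anticomplete sets, each joining two fixed non-adjacent vertices,
give a theta. -/
theorem containsTheta_of_reaches {G : SimpleGraph V} {x y : V} (hne : x ≠ y)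
    (hxy : ¬ G.Adj x y) {A B C : Set V}
    (hAB : Disjoint A B) (hAC : Disjoint A C) (hBC : Disjoint B C)
    (hAB' : Anticomplete G A B) (hAC' : Anticomplete G A C) (hBC' : Anticomplete G B C)
    (hA : Reaches G (A ∪ {x, y}) x y) (hB : Reaches G (B ∪ {x, y}) x y)
    (hC : Reaches G (C ∪ {x, y}) x y) : ContainsTheta G := by
  obtain ⟨P, hP, hPi, hPA⟩ := hA.exists_inducedWalk
  obtain ⟨Q, hQ, hQi, hQB⟩ := hB.exists_inducedWalk
  obtain ⟨R, hR, hRi, hRC⟩ := hC.exists_inducedWalk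
  have hint {D : Set V} (W : G.Walk x y) (hW : ∀ t ∈ W.support, t ∈ D ∪ {x, y}) :
      Interior W ⊆ D := fun t ht => (hW t ht.1).resolve_right <| by
    simp [ht.2.1, ht.2.2]
  have hP' := hint P hPA
  have hQ' := hint Q hQB
  have hR' := hint R hRC
  exact ⟨x, y, P, Q, R, hne, hxy, hP, hQ, hR, hPi, hQi, hRi,
    two_le_length_of_not_adj hne hxy P, two_le_length_of_not_adj hne hxy Q,
    two_le_length_of_not_adj hne hxy R, hAB.mono hP' hQ', hAC.mono hP' hR', hBC.mono hQ' hR',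
    fun s hs t ht => hAB' s (hP' hs) t (hQ' ht), fun s hs t ht => hAC' s (hP' hs) t (hR' ht),
    fun s hs t ht => hBC' s (hQ' hs) t (hR' ht)⟩

/-- Two triangles joined by three pairwise disjoint sets that are anticomplete apart from the
edges of the triangles give a prism. -/
theorem containsPrism_of_reaches {G : SimpleGraph V} {a b : Fin 3 → V} {S : Fin 3 → Set V}
    (ha : ∀ i j, i ≠ j → G.Adj (a i) (a j)) (hb : ∀ i j, i ≠ j → G.Adj (b i) (b j))
    (hS : ∀ i, Reaches G (S i) (a i) (b i))
    (hdisj : ∀ i j, i < j → ∀ x ∈ S i, x ∉ S j)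
    (hedge : ∀ i j, i < j → ∀ x ∈ S i, ∀ y ∈ S j, G.Adj x y →
      (x = a i ∧ y = a j) ∨ (x = b i ∧ y = b j))
    (hne : ∀ i, i ≠ 0 → a i ≠ b i) (hadj : ∀ i, i ≠ 0 → ¬ G.Adj (a i) (b i)) :
    ContainsPrism G := by
  choose P hP hPi hPS using fun i => (hS i).exists_inducedWalk
  refine ⟨a, b, P, ha, hb, hP, hPi, fun i j hij x hx hx' => ?_, fun i j hij x hx y hy hxy => ?_,
    fun i j hij => ?_⟩
  · rcases hij.lt_or_gt with h | h
    · exact hdisj i j h x (hPS i x hx) (hPS j x hx')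
    · exact hdisj j i h x (hPS j x hx') (hPS i x hx)
  · rcases hij.lt_or_gt with h | h
    · exact hedge i j h x (hPS i x hx) y (hPS j y hy) hxy
    · exact (hedge j i h y (hPS j y hy) x (hPS i x hx) hxy.symm).imp And.symm And.symm
  · have h2 (l : Fin 3) (hl : l ≠ 0) : 2 ≤ (P l).length :=
      two_le_length_of_not_adj (hne l hl) (hadj l hl) (P l)
    by_cases hi : i = 0
    · have := h2 j (hi ▸ hij.symm)
      omega
    · have := h2 i hi
      omega

/-- A pyramid given by the sequences of vertices along its paths: the path `p i` runs from the
apex `a = p i 0` to the base vertex `p i (L i)`. -/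
structure PyramidSeq (G : SimpleGraph V) (a : V) (p : Fin 3 → ℕ → V) (L : Fin 3 → ℕ) : Prop where
  zero : ∀ i, p i 0 = a
  pos : ∀ i, 1 ≤ L i
  adj_iff : ∀ i m n, m ≤ L i → n ≤ L i → (G.Adj (p i m) (p i n) ↔ m + 1 = n ∨ n + 1 = m)
  inj : ∀ i m n, m ≤ L i → n ≤ L i → p i m = p i n → m = n
  eq_zero : ∀ i j m n, i ≠ j → m ≤ L i → n ≤ L j → p i m = p j n → m = 0 ∧ n = 0
  cross : ∀ i j m n, i ≠ j → m ≤ L i → n ≤ L j → 0 < m → 0 < n → G.Adj (p i m) (p j n) →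
    m = L i ∧ n = L j
  base : ∀ i j, i ≠ j → G.Adj (p i (L i)) (p j (L j))

theorem IsPyramid.pyramidSeq {G : SimpleGraph V} {a : V} {b : Fin 3 → V}
    {P : ∀ i, G.Walk a (b i)} (h : IsPyramid G a b P) :
    PyramidSeq G a (fun i => (P i).getVert) (fun i => (P i).length) := by
  obtain ⟨-, hb, hP, hPi, hlen, hdisj, hcross, -⟩ := h
  have hinj (i : Fin 3) (m n : ℕ) (hm : m ≤ (P i).length) (hn : n ≤ (P i).length)
      (he : (P i).getVert m = (P i).getVert n) : m = n :=
    (hP i).getVert_injOn hm hn he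
  have hz (i : Fin 3) (m : ℕ) (hm : m ≤ (P i).length) (he : (P i).getVert m = a) : m = 0 :=
    hinj i m 0 hm (Nat.zero_le _) (by rw [he, Walk.getVert_zero])
  refine ⟨fun i => (P i).getVert_zero, hlen, fun i m n hm hn => ⟨fun hadj => ?_, ?_⟩, hinj,
    fun i j m n hij hm hn he => ?_, fun i j m n hij hm hn hm0 hn0 hadj => ?_,
    fun i j hij => ?_⟩
  · have hmem := hPi i _ ((P i).getVert_mem_support m) _ ((P i).getVert_mem_support n) hadj
    obtain ⟨k, hkl, hk⟩ := (P i).mk_mem_edges_iff_exists.1 hmem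
    rcases Sym2.eq_iff.1 hk with ⟨h1, h2⟩ | ⟨h1, h2⟩
    · have := hinj i _ _ (by omega) (by omega) h1
      have := hinj i _ _ (by omega) (by omega) h2
      omega
    · have := hinj i _ _ (by omega) (by omega) h1
      have := hinj i _ _ (by omega) (by omega) h2
      omega
  · rintro (rfl | rfl)
    · exact (P i).adj_getVert_succ (by omega)
    · exact ((P i).adj_getVert_succ (by omega)).symm
  · have hx := hdisj i j hij _ ((P i).getVert_mem_support m) (he ▸ (P j).getVert_mem_support n)
    exact ⟨hz i m hm hx, hz j n hn (he ▸ hx)⟩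
  · obtain ⟨h1, h2⟩ := hcross i j hij _ ((P i).getVert_mem_support m) _
      ((P j).getVert_mem_support n) (fun hx => hm0.ne' (hz i m hm hx))
      (fun hx => hn0.ne' (hz j n hn hx)) hadj
    exact ⟨hinj i _ _ hm le_rfl (by rw [h1, Walk.getVert_length]),
      hinj j _ _ hn le_rfl (by rw [h2, Walk.getVert_length])⟩
  · simpa using hb i j hij

/-- The vertices of the sequence `f` with index between `m` and `n`. -/
def Arc (f : ℕ → V) (m n : ℕ) : Set V :=
  {x | ∃ k, m ≤ k ∧ k ≤ n ∧ f k = x}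

theorem mem_arc {f : ℕ → V} {m n k : ℕ} (hm : m ≤ k) (hn : k ≤ n) : f k ∈ Arc f m n :=
  ⟨k, hm, hn, rfl⟩

namespace PyramidSeq

variable {G : SimpleGraph V} {a : V} {p : Fin 3 → ℕ → V} {L : Fin 3 → ℕ} {i j : Fin 3}
  {m n m' n' : ℕ}

theorem reaches (h : PyramidSeq G a p L) (hmn : m ≤ n) (hn : n ≤ L i) :
    Reaches G (Arc (p i) m n) (p i m) (p i n) :=
  Reaches.of_seq hmn (fun _ h1 h2 => mem_arc h1 h2) fun k _ h2 =>
    (h.adj_iff i k (k + 1) (by omega) (by omega)).2 (.inl rfl)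

theorem arc_disjoint (h : PyramidSeq G a p L) (hn : n < m') (hn' : n' ≤ L i) :
    Disjoint (Arc (p i) m n) (Arc (p i) m' n') := by
  refine Set.disjoint_left.2 ?_
  rintro _ ⟨k, h1, h2, rfl⟩ ⟨l, h3, h4, he⟩
  have := h.inj i l k (by omega) (by omega) he
  omega

theorem arc_anticomplete (h : PyramidSeq G a p L) (hn : n + 1 < m') (hn' : n' ≤ L i) :
    Anticomplete G (Arc (p i) m n) (Arc (p i) m' n') := by
  rintro _ ⟨k, h1, h2, rfl⟩ _ ⟨l, h3, h4, rfl⟩ hadj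
  have := (h.adj_iff i k l (by omega) (by omega)).1 hadj
  omega

theorem arc_disjoint_arc (h : PyramidSeq G a p L) (hij : i ≠ j) (hn : n ≤ L i) (hn' : n' ≤ L j)
    (hm : 1 ≤ m ∨ 1 ≤ m') : Disjoint (Arc (p i) m n) (Arc (p j) m' n') := by
  refine Set.disjoint_left.2 ?_
  rintro _ ⟨k, h1, h2, rfl⟩ ⟨l, h3, h4, he⟩
  have := h.eq_zero j i l k hij.symm (by omega) (by omega) he
  omega

theorem arc_anticomplete_arc (h : PyramidSeq G a p L) (hij : i ≠ j) (hm : 1 ≤ m) (hm' : 1 ≤ m')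
    (hn : n ≤ L i) (hn' : n' ≤ L j) (hlt : n < L i ∨ n' < L j) :
    Anticomplete G (Arc (p i) m n) (Arc (p j) m' n') := by
  rintro _ ⟨k, h1, h2, rfl⟩ _ ⟨l, h3, h4, rfl⟩ hadj
  have := h.cross i j k l hij (by omega) (by omega) (by omega) (by omega) hadj
  omega

end PyramidSeq

/-- A connected set `S` outside a pyramid attaching to the path `i` only at `q` and to the path `j`
only at `q'`, away from the base, the apex and the neighbors of the apex. -/
structure Connector (G : SimpleGraph V) (p : Fin 3 → ℕ → V) (L : Fin 3 → ℕ) (i j : Fin 3)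
    (S : Set V) (q q' : V) : Prop where
  reaches : Reaches G S q q'
  ne : ∀ z ∈ S, ∀ l m, m ≤ L l → z ≠ p l m
  bounds : ∀ z ∈ S, ∀ l m, m ≤ L l → G.Adj z (p l m) → 2 ≤ m ∧ m < L l
  eq_left : ∀ z ∈ S, ∀ m ≤ L i, G.Adj z (p i m) → z = q
  eq_right : ∀ z ∈ S, ∀ m ≤ L j, G.Adj z (p j m) → z = q'
  other : ∀ z ∈ S, ∀ k, k ≠ i → k ≠ j → ∀ m ≤ L k, ¬ G.Adj z (p k m)
  nbr_left : ∃ m ≤ L i, G.Adj q (p i m)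
  nbr_right : ∃ m ≤ L j, G.Adj q' (p j m)

namespace Connector

variable {G : SimpleGraph V} {a : V} {p : Fin 3 → ℕ → V} {L : Fin 3 → ℕ} {i j k : Fin 3}
  {S : Set V} {q q' : V} {m n : ℕ}

theorem symm (c : Connector G p L i j S q q') : Connector G p L j i S q' q where
  reaches := c.reaches.symm
  ne := c.ne
  bounds := c.bounds
  eq_left := c.eq_right
  eq_right := c.eq_left
  other z hz k hk hk' := c.other z hz k hk' hk
  nbr_left := c.nbr_right
  nbr_right := c.nbr_left

theorem mem_left (c : Connector G p L i j S q q') : q ∈ S := c.reaches.mem_left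

theorem disjoint_arc (c : Connector G p L i j S q q') (l : Fin 3) (hn : n ≤ L l) :
    Disjoint S (Arc (p l) m n) := by
  refine Set.disjoint_left.2 ?_
  rintro _ hz ⟨k, h1, h2, rfl⟩
  exact c.ne _ hz l k (by omega) rfl

/-- The connecting set together with the path `j` up to the apex. -/
theorem reaches_apex (h : PyramidSeq G a p L) (c : Connector G p L i j S q q') :
    Reaches G (S ∪ Arc (p j) 0 (L j - 1)) q a := by
  obtain ⟨n, hn, hadj⟩ := c.nbr_right
  obtain ⟨hn2, hnL⟩ := c.bounds q' c.symm.mem_left j n hn hadj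
  have hr := h.reaches (i := j) (Nat.zero_le n) hn
  rw [h.zero] at hr
  refine (c.reaches.mono Set.subset_union_left).trans ((Reaches.of_adj ?_ ?_ hadj).trans ?_)
  · exact .inl c.symm.mem_left
  · exact .inr (mem_arc (Nat.zero_le n) (by omega))
  · refine hr.symm.mono fun x hx => .inr ?_
    obtain ⟨k, h1, h2, rfl⟩ := hx
    exact mem_arc h1 (by omega)

theorem arc_zero_subset (h : PyramidSeq G a p L) (l : Fin 3) (n : ℕ) :
    Arc (p l) 0 n ⊆ Arc (p l) 1 n ∪ {a} := by
  rintro _ ⟨k, h1, h2, rfl⟩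
  rcases Nat.eq_zero_or_pos k with rfl | hk
  · exact .inr (h.zero l)
  · exact .inl (mem_arc hk h2)

/-- From a vertex of the path `i`, the apex is reached through the base and the path `k`. -/
theorem reaches_apex_via_base (h : PyramidSeq G a p L) (hik : i ≠ k) (hn : n ≤ L i) :
    Reaches G (Arc (p i) n (L i) ∪ Arc (p k) 1 (L k) ∪ {a}) (p i n) a := by
  have hr := (h.reaches (i := k) (Nat.zero_le _) le_rfl).symm
  rw [h.zero] at hr
  refine ((h.reaches hn le_rfl).mono fun x hx => .inl (.inl hx)).trans
    ((Reaches.of_adj ?_ ?_ (h.base i k hik)).trans (hr.mono ?_))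
  · exact .inl (.inl (mem_arc hn le_rfl))
  · exact .inl (.inr (mem_arc (h.pos k) le_rfl))
  · intro x hx
    rcases arc_zero_subset h k _ hx with hx | hx
    exacts [.inl (.inr hx), .inr hx]

theorem containsTheta_of_unique (h : PyramidSeq G a p L) (c : Connector G p L i j S q q')
    (hij : i ≠ j) (hki : k ≠ i) (hkj : k ≠ j) (hn : n ≤ L i) (hadj : G.Adj q (p i n))
    (huniq : ∀ m ≤ L i, G.Adj q (p i m) → m = n) : ContainsTheta G := by
  obtain ⟨hn2, hnL⟩ := c.bounds q c.mem_left i n hn hadj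
  have hattach (z : V) (hz : z ∈ S) (m : ℕ) (hm : m ≤ L i) (hzm : G.Adj z (p i m)) : m = n :=
    huniq m hm (c.eq_left z hz m hm hzm ▸ hzm)
  have hL (l : Fin 3) : 1 ≤ L l := h.pos l
  refine containsTheta_of_reaches (x := p i n) (y := a) (A := Arc (p i) 1 (n - 1))
    (B := Arc (p i) (n + 1) (L i) ∪ Arc (p k) 1 (L k)) (C := S ∪ Arc (p j) 1 (L j - 1))
    ?_ ?_ ?_ ?_ ?_ ?_ ?_ ?_ ?_ ?_ ?_
  · intro he
    have := h.inj i n 0 hn (Nat.zero_le _) (he.trans (h.zero i).symm)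
    omega
  · rw [← h.zero i, h.adj_iff i n 0 hn (Nat.zero_le _)]
    omega
  · exact Set.disjoint_union_right.2 ⟨h.arc_disjoint (by omega) le_rfl,
      h.arc_disjoint_arc hki.symm (by omega) le_rfl (.inl le_rfl)⟩
  · exact Set.disjoint_union_right.2 ⟨(c.disjoint_arc i (by omega)).symm,
      h.arc_disjoint_arc hij (by omega) (by omega) (.inl le_rfl)⟩
  · exact Set.disjoint_union_left.2 ⟨Set.disjoint_union_right.2 ⟨(c.disjoint_arc i le_rfl).symm,
      h.arc_disjoint_arc hij le_rfl (by omega) (.inr le_rfl)⟩,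
      Set.disjoint_union_right.2 ⟨(c.disjoint_arc k le_rfl).symm,
      h.arc_disjoint_arc hkj le_rfl (by omega) (.inr le_rfl)⟩⟩
  · rintro x hx y (hy | hy)
    · exact h.arc_anticomplete (by omega) le_rfl x hx y hy
    · exact h.arc_anticomplete_arc hki.symm le_rfl le_rfl (by omega) le_rfl (.inl (by omega))
        x hx y hy
  · rintro x hx y (hy | hy)
    · obtain ⟨l, h1, h2, rfl⟩ := hx
      intro hxy
      have := hattach y hy l (by omega) hxy.symm
      omega
    · exact h.arc_anticomplete_arc hij le_rfl le_rfl (by omega) (by omega) (.inl (by omega))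
        x hx y hy
  · rintro x (hx | hx) y (hy | hy)
    · obtain ⟨l, h1, h2, rfl⟩ := hx
      intro hxy
      have := hattach y hy l (by omega) hxy.symm
      omega
    · have := hL j
      exact h.arc_anticomplete_arc hij (by omega) le_rfl le_rfl (by omega) (.inr (by omega))
        x hx y hy
    · obtain ⟨l, h1, h2, rfl⟩ := hx
      exact fun hxy => c.other y hy k hki hkj l h2 hxy.symm
    · have := hL j
      exact h.arc_anticomplete_arc hkj le_rfl le_rfl le_rfl (by omega) (.inr (by omega))
        x hx y hy
  · have hr := (h.reaches (i := i) (Nat.zero_le n) hn).symm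
    rw [h.zero] at hr
    refine hr.mono ?_
    rintro _ ⟨l, h1, h2, rfl⟩
    rcases Nat.eq_zero_or_pos l with rfl | hl
    · exact .inr (.inr (h.zero i))
    · rcases h2.eq_or_lt with rfl | hl'
      · exact .inr (.inl rfl)
      · exact .inl (mem_arc hl (by omega))
  · refine (reaches_apex_via_base h hki.symm hn).mono ?_
    rintro x ((⟨l, h1, h2, rfl⟩ | hx) | rfl)
    · rcases h1.eq_or_lt with rfl | hl
      · exact .inr (.inl rfl)
      · exact .inl (.inl (mem_arc hl h2))
    · exact .inl (.inr hx)
    · exact .inr (.inr rfl)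
  · refine (Reaches.of_adj (.inr (.inl rfl)) (.inl (.inl c.mem_left)) hadj.symm).trans
      ((c.reaches_apex h).mono ?_)
    rintro x (hx | hx)
    · exact .inl (.inl hx)
    · rcases arc_zero_subset h j _ hx with hx | hx
      exacts [.inl (.inr hx), .inr (.inr hx)]

theorem containsTheta_of_lt (h : PyramidSeq G a p L) (c : Connector G p L i j S q q')
    (hij : i ≠ j) (hki : k ≠ i) (hkj : k ≠ j) (hn : n ≤ L i) (hmn : m + 1 < n)
    (hqm : G.Adj q (p i m)) (hqn : G.Adj q (p i n)) : ContainsTheta G := by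
  obtain ⟨hn2, hnL⟩ := c.bounds q c.mem_left i n hn hqn
  obtain ⟨hm2, hmL⟩ := c.bounds q c.mem_left i m (by omega) hqm
  have hL (l : Fin 3) : 1 ≤ L l := h.pos l
  have hSi : Anticomplete G (Arc (p i) 1 (L i)) (S \ {q}) := by
    rintro _ ⟨l, h1, h2, rfl⟩ y hy hxy
    exact hy.2 (c.eq_left y hy.1 l h2 hxy.symm)
  refine containsTheta_of_reaches (x := q) (y := a) (A := Arc (p i) 1 m)
    (B := Arc (p i) n (L i) ∪ Arc (p k) 1 (L k)) (C := S \ {q} ∪ Arc (p j) 1 (L j - 1))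
    ?_ ?_ ?_ ?_ ?_ ?_ ?_ ?_ ?_ ?_ ?_
  · exact fun he => c.ne q c.mem_left i 0 (Nat.zero_le _) (he.trans (h.zero i).symm)
  · intro hqa
    rw [← h.zero i] at hqa
    have := c.bounds q c.mem_left i 0 (Nat.zero_le _) hqa
    omega
  · exact Set.disjoint_union_right.2 ⟨h.arc_disjoint (by omega) le_rfl,
      h.arc_disjoint_arc hki.symm (by omega) le_rfl (.inl le_rfl)⟩
  · exact Set.disjoint_union_right.2
      ⟨((c.disjoint_arc i (by omega)).mono_left Set.sdiff_subset).symm,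
      h.arc_disjoint_arc hij (by omega) (by omega) (.inl le_rfl)⟩
  · exact Set.disjoint_union_left.2 ⟨Set.disjoint_union_right.2
      ⟨((c.disjoint_arc i le_rfl).mono_left Set.sdiff_subset).symm,
      h.arc_disjoint_arc hij le_rfl (by omega) (.inr le_rfl)⟩,
      Set.disjoint_union_right.2 ⟨((c.disjoint_arc k le_rfl).mono_left Set.sdiff_subset).symm,
      h.arc_disjoint_arc hkj le_rfl (by omega) (.inr le_rfl)⟩⟩
  · rintro x hx y (hy | hy)
    · exact h.arc_anticomplete (by omega) le_rfl x hx y hy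
    · exact h.arc_anticomplete_arc hki.symm le_rfl le_rfl (by omega) le_rfl (.inl (by omega))
        x hx y hy
  · rintro x hx y (hy | hy)
    · obtain ⟨l, h1, h2, rfl⟩ := hx
      exact hSi _ (mem_arc h1 (by omega)) y hy
    · exact h.arc_anticomplete_arc hij le_rfl le_rfl (by omega) (by omega) (.inl (by omega))
        x hx y hy
  · have := hL j
    rintro x (hx | hx) y (hy | hy)
    · obtain ⟨l, h1, h2, rfl⟩ := hx
      exact hSi _ (mem_arc (by omega) h2) y hy
    · exact h.arc_anticomplete_arc hij (by omega) le_rfl le_rfl (by omega) (.inr (by omega))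
        x hx y hy
    · obtain ⟨l, h1, h2, rfl⟩ := hx
      exact fun hxy => c.other y hy.1 k hki hkj l h2 hxy.symm
    · exact h.arc_anticomplete_arc hkj le_rfl le_rfl le_rfl (by omega) (.inr (by omega))
        x hx y hy
  · have hr := (h.reaches (i := i) (Nat.zero_le m) (by omega)).symm
    rw [h.zero] at hr
    refine (Reaches.of_adj (.inr (.inl rfl)) (.inl (mem_arc (by omega) le_rfl)) hqm).trans
      (hr.mono fun x hx => ?_)
    rcases arc_zero_subset h i _ hx with hx | hx
    exacts [.inl hx, .inr (.inr hx)]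
  · refine (Reaches.of_adj (.inr (.inl rfl)) (.inl (.inl (mem_arc le_rfl hn))) hqn).trans
      ((reaches_apex_via_base h hki.symm hn).mono ?_)
    rintro x (hx | rfl)
    exacts [.inl hx, .inr (.inr rfl)]
  · refine (c.reaches_apex h).mono ?_
    rintro x (hx | hx)
    · by_cases hxq : x = q
      · exact .inr (.inl hxq)
      · exact .inl (.inl ⟨hx, hxq⟩)
    · rcases arc_zero_subset h j _ hx with hx | hx
      exacts [.inl (.inr hx), .inr (.inr hx)]

/-- In a theta-free graph, a connector has exactly two neighbors on a path, and they are
consecutive. -/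
theorem exists_consecutive (hth : ¬ ContainsTheta G) (h : PyramidSeq G a p L)
    (c : Connector G p L i j S q q') (hij : i ≠ j) (hki : k ≠ i) (hkj : k ≠ j) :
    ∃ n, 2 ≤ n ∧ n + 1 < L i ∧ G.Adj q (p i n) ∧ G.Adj q (p i (n + 1)) ∧
      ∀ m ≤ L i, G.Adj q (p i m) → m = n ∨ m = n + 1 := by
  obtain ⟨n, hn, hqn⟩ := c.nbr_left
  have hclose (m n : ℕ) (hn : n ≤ L i) (hqm : G.Adj q (p i m)) (hqn : G.Adj q (p i n)) :
      n ≤ m + 1 := by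
    by_contra! hlt
    exact hth (c.containsTheta_of_lt h hij hki hkj hn hlt hqm hqn)
  obtain ⟨m, hm, hqm, hmn⟩ : ∃ m ≤ L i, G.Adj q (p i m) ∧ m ≠ n := by
    by_contra! hall
    exact hth (c.containsTheta_of_unique h hij hki hkj hn hqn hall)
  have h1 := hclose m n hn hqm hqn
  have h2 := hclose n m hm hqn hqm
  have h3 := c.bounds q c.mem_left i m hm hqm
  have h4 := c.bounds q c.mem_left i n hn hqn
  rcases hmn.lt_or_gt with hlt | hlt
  · obtain rfl : n = m + 1 := by omega
    refine ⟨m, by omega, by omega, hqm, hqn, fun l hl hql => ?_⟩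
    have h5 := hclose l (m + 1) hn hql hqn
    have h6 := hclose m l hl hqm hql
    omega
  · obtain rfl : m = n + 1 := by omega
    refine ⟨n, by omega, by omega, hqn, hqm, fun l hl hql => ?_⟩
    have h5 := hclose l (n + 1) hm hql hqm
    have h6 := hclose n l hl hqn hql
    omega

theorem containsPrism (h : PyramidSeq G a p L) (c : Connector G p L i j S q q') (hij : i ≠ j)
    (hm2 : 2 ≤ m) (hmL : m + 1 < L i) (hn2 : 2 ≤ n) (hnL : n + 1 < L j)
    (hqm : G.Adj q (p i m)) (hqm' : G.Adj q (p i (m + 1)))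
    (hqn : G.Adj q' (p j n)) (hqn' : G.Adj q' (p j (n + 1)))
    (hm : ∀ l ≤ L i, G.Adj q (p i l) → l = m ∨ l = m + 1)
    (hn : ∀ l ≤ L j, G.Adj q' (p j l) → l = n ∨ l = n + 1) : ContainsPrism G := by
  have hmm : G.Adj (p i m) (p i (m + 1)) := (h.adj_iff i _ _ (by omega) (by omega)).2 (.inl rfl)
  have hnn : G.Adj (p j n) (p j (n + 1)) := (h.adj_iff j _ _ (by omega) (by omega)).2 (.inl rfl)
  have hSi (x : V) (hx : x ∈ S) (l : ℕ) (hl : l ≤ L i) (hxl : G.Adj x (p i l)) :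
      x = q ∧ (l = m ∨ l = m + 1) := by
    obtain rfl := c.eq_left x hx l hl hxl
    exact ⟨rfl, hm l hl hxl⟩
  have hSj (x : V) (hx : x ∈ S) (l : ℕ) (hl : l ≤ L j) (hxl : G.Adj x (p j l)) :
      x = q' ∧ (l = n ∨ l = n + 1) := by
    obtain rfl := c.eq_right x hx l hl hxl
    exact ⟨rfl, hn l hl hxl⟩
  refine containsPrism_of_reaches (a := ![q, p i m, p i (m + 1)])
    (b := ![q', p j n, p j (n + 1)])
    (S := ![S, Arc (p i) 0 m ∪ Arc (p j) 0 n, Arc (p i) (m + 1) (L i) ∪ Arc (p j) (n + 1) (L j)])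
    ?_ ?_ ?_ ?_ ?_ ?_ ?_
  · intro s t hst
    fin_cases s <;> fin_cases t <;> simp_all [G.adj_comm]
  · intro s t hst
    fin_cases s <;> fin_cases t <;> simp_all [G.adj_comm]
  · have h1 : Reaches G (Arc (p i) 0 m ∪ Arc (p j) 0 n) (p i m) (p j n) := by
      have hr := (h.reaches (i := i) (Nat.zero_le m) (by omega)).symm
      have hr' := h.reaches (i := j) (Nat.zero_le n) (by omega)
      rw [h.zero] at hr hr'
      exact (hr.mono Set.subset_union_left).trans (hr'.mono Set.subset_union_right)
    have h2 : Reaches G (Arc (p i) (m + 1) (L i) ∪ Arc (p j) (n + 1) (L j))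
        (p i (m + 1)) (p j (n + 1)) :=
      ((h.reaches (i := i) (by omega) le_rfl).mono Set.subset_union_left).trans
        ((Reaches.of_adj (.inl (mem_arc (by omega) le_rfl)) (.inr (mem_arc (by omega) le_rfl))
          (h.base i j hij)).trans
        ((h.reaches (i := j) (by omega) le_rfl).symm.mono Set.subset_union_right))
    intro s
    fin_cases s
    exacts [c.reaches, h1, h2]
  · have h01 : ∀ x ∈ S, x ∉ Arc (p i) 0 m ∪ Arc (p j) 0 n := fun x hx =>
      Set.disjoint_left.1 (Set.disjoint_union_right.2
        ⟨c.disjoint_arc i (by omega), c.disjoint_arc j (by omega)⟩) hx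
    have h02 : ∀ x ∈ S, x ∉ Arc (p i) (m + 1) (L i) ∪ Arc (p j) (n + 1) (L j) := fun x hx =>
      Set.disjoint_left.1 (Set.disjoint_union_right.2
        ⟨c.disjoint_arc i le_rfl, c.disjoint_arc j le_rfl⟩) hx
    have h12 : ∀ x ∈ Arc (p i) 0 m ∪ Arc (p j) 0 n,
        x ∉ Arc (p i) (m + 1) (L i) ∪ Arc (p j) (n + 1) (L j) := fun x hx =>
      Set.disjoint_left.1 (Set.disjoint_union_left.2
        ⟨Set.disjoint_union_right.2 ⟨h.arc_disjoint (by omega) le_rfl,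
          h.arc_disjoint_arc hij (by omega) le_rfl (.inr (by omega))⟩,
        Set.disjoint_union_right.2
          ⟨h.arc_disjoint_arc hij.symm (by omega) le_rfl (.inr (by omega)),
          h.arc_disjoint (by omega) le_rfl⟩⟩) hx
    intro s t hst
    fin_cases s <;> fin_cases t <;> first | exact absurd hst (by decide) | assumption
  · have h01 : ∀ x ∈ S, ∀ y ∈ Arc (p i) 0 m ∪ Arc (p j) 0 n, G.Adj x y →
        (x = q ∧ y = p i m) ∨ (x = q' ∧ y = p j n) := by
      rintro x hx y (⟨l, h1, h2, rfl⟩ | ⟨l, h1, h2, rfl⟩) hxy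
      · obtain ⟨rfl, hl⟩ := hSi x hx l (by omega) hxy
        obtain rfl : l = m := by omega
        exact .inl ⟨rfl, rfl⟩
      · obtain ⟨rfl, hl⟩ := hSj x hx l (by omega) hxy
        obtain rfl : l = n := by omega
        exact .inr ⟨rfl, rfl⟩
    have h02 : ∀ x ∈ S, ∀ y ∈ Arc (p i) (m + 1) (L i) ∪ Arc (p j) (n + 1) (L j), G.Adj x y →
        (x = q ∧ y = p i (m + 1)) ∨ (x = q' ∧ y = p j (n + 1)) := by
      rintro x hx y (⟨l, h1, h2, rfl⟩ | ⟨l, h1, h2, rfl⟩) hxy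
      · obtain ⟨rfl, hl⟩ := hSi x hx l (by omega) hxy
        obtain rfl : l = m + 1 := by omega
        exact .inl ⟨rfl, rfl⟩
      · obtain ⟨rfl, hl⟩ := hSj x hx l (by omega) hxy
        obtain rfl : l = n + 1 := by omega
        exact .inr ⟨rfl, rfl⟩
    have hapex (s t : Fin 3) (hst : s ≠ t) (l r : ℕ) (hl : l < L s) (hr : 2 ≤ r) (hrL : r ≤ L t) :
        ¬ G.Adj (p s l) (p t r) := by
      intro hadj
      rcases Nat.eq_zero_or_pos l with rfl | hl0
      · rw [h.zero s, ← h.zero t, h.adj_iff t _ _ (by omega) hrL] at hadj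
        omega
      · have := h.cross s t l r hst hl.le hrL hl0 (by omega) hadj
        omega
    have h12 : ∀ x ∈ Arc (p i) 0 m ∪ Arc (p j) 0 n,
        ∀ y ∈ Arc (p i) (m + 1) (L i) ∪ Arc (p j) (n + 1) (L j), G.Adj x y →
        (x = p i m ∧ y = p i (m + 1)) ∨ (x = p j n ∧ y = p j (n + 1)) := by
      rintro x (⟨l, h1, h2, rfl⟩ | ⟨l, h1, h2, rfl⟩) y (⟨r, h3, h4, rfl⟩ | ⟨r, h3, h4, rfl⟩) hxy
      · have := (h.adj_iff i l r (by omega) (by omega)).1 hxy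
        obtain ⟨rfl, rfl⟩ : l = m ∧ r = m + 1 := by omega
        exact .inl ⟨rfl, rfl⟩
      · exact absurd hxy (hapex i j hij l r (by omega) (by omega) h4)
      · exact absurd hxy (hapex j i hij.symm l r (by omega) (by omega) h4)
      · have := (h.adj_iff j l r (by omega) (by omega)).1 hxy
        obtain ⟨rfl, rfl⟩ : l = n ∧ r = n + 1 := by omega
        exact .inr ⟨rfl, rfl⟩
    intro s t hst
    fin_cases s <;> fin_cases t <;> first | exact absurd hst (by decide) | assumption
  · have h1 (l r : ℕ) (hl : 1 ≤ l) (hlL : l ≤ L i) (hr : r ≤ L j) : p i l ≠ p j r := fun he => by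
      have := h.eq_zero i j l r hij hlL hr he
      omega
    intro s hs
    fin_cases s
    exacts [absurd rfl hs, h1 _ _ (by omega) (by omega) (by omega),
      h1 _ _ (by omega) (by omega) (by omega)]
  · have h1 (l r : ℕ) (hl : 1 ≤ l) (hlL : l < L i) (hr : 1 ≤ r) (hrL : r ≤ L j) :
        ¬ G.Adj (p i l) (p j r) := fun he => by
      have := h.cross i j l r hij hlL.le hrL (by omega) (by omega) he
      omega
    intro s hs
    fin_cases s
    exacts [absurd rfl hs, h1 _ _ (by omega) (by omega) (by omega) (by omega),
      h1 _ _ (by omega) (by omega) (by omega) (by omega)]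

theorem containsTheta_or_containsPrism (h : PyramidSeq G a p L)
    (c : Connector G p L i j S q q') (hij : i ≠ j) : ContainsTheta G ∨ ContainsPrism G := by
  by_contra! hcon
  obtain ⟨k, hki, hkj⟩ : ∃ k : Fin 3, k ≠ i ∧ k ≠ j := by
    clear c
    revert i j
    decide
  obtain ⟨m, hm2, hmL, hqm, hqm', hm⟩ := c.exists_consecutive hcon.1 h hij hki hkj
  obtain ⟨n, hn2, hnL, hqn, hqn', hn⟩ := c.symm.exists_consecutive hcon.1 h hij.symm hkj hki
  exact hcon.2 (c.containsPrism h hij hm2 hmL hn2 hnL hqm hqm' hqn hqn' hm hn)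

end Connector

/-- A vertex outside a pyramid with neighbors in the inner part of all three paths gives a theta. -/
theorem PyramidSeq.containsTheta_of_forall_adj {G : SimpleGraph V} {a q : V} {p : Fin 3 → ℕ → V}
    {L : Fin 3 → ℕ} (h : PyramidSeq G a p L) (hne : q ≠ a)
    (hb : ∀ l m, m ≤ L l → G.Adj q (p l m) → 2 ≤ m ∧ m < L l)
    (hq : ∀ l, ∃ m ≤ L l, G.Adj q (p l m)) : ContainsTheta G := by
  have hL (l : Fin 3) : 1 ≤ L l := h.pos l
  have hd (s t : Fin 3) (hst : s ≠ t) :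
      Disjoint (Arc (p s) 1 (L s - 1)) (Arc (p t) 1 (L t - 1)) :=
    h.arc_disjoint_arc hst (by omega) (by omega) (.inl le_rfl)
  have ha (s t : Fin 3) (hst : s ≠ t) :
      Anticomplete G (Arc (p s) 1 (L s - 1)) (Arc (p t) 1 (L t - 1)) := by
    have := hL s
    exact h.arc_anticomplete_arc hst le_rfl le_rfl (by omega) (by omega) (.inl (by omega))
  have hr (l : Fin 3) : Reaches G (Arc (p l) 1 (L l - 1) ∪ {q, a}) q a := by
    obtain ⟨m, hm, hqm⟩ := hq l
    obtain ⟨h1, h2⟩ := hb l m hm hqm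
    have hr := (h.reaches (i := l) (Nat.zero_le m) hm).symm
    rw [h.zero] at hr
    refine (Reaches.of_adj (.inr (.inl rfl)) (.inl (mem_arc (by omega) (by omega))) hqm).trans
      (hr.mono ?_)
    rintro _ ⟨k, h3, h4, rfl⟩
    rcases Nat.eq_zero_or_pos k with rfl | hk
    · exact .inr (.inr (h.zero l))
    · exact .inl (mem_arc hk (by omega))
  refine containsTheta_of_reaches hne ?_ (hd 0 1 (by decide)) (hd 0 2 (by decide))
    (hd 1 2 (by decide)) (ha 0 1 (by decide)) (ha 0 2 (by decide)) (ha 1 2 (by decide))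
    (hr 0) (hr 1) (hr 2)
  intro hqa
  rw [← h.zero 0] at hqa
  have := hb 0 0 (Nat.zero_le _) hqa
  omega

/-- Deleting a set of vertices that meets every walk between two sides separates them. -/
theorem separates_of_not_reaches {G : SimpleGraph V} {M : Set V} {u v : V} (hu : u ∉ M)
    (hv : v ∉ M) (h : ¬ Reaches G Mᶜ u v) : Separates G M u v := by
  have hL : ∀ x, Reaches G Mᶜ u x → x ∉ M := fun x hx => hx.symm.mem_left
  refine ⟨{x | Reaches G Mᶜ u x}, {x | x ∉ M ∧ ¬ Reaches G Mᶜ u x}, ?_, ?_, ?_, ?_,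
    ⟨u, .refl hu⟩, ⟨v, hv, h⟩, ?_, .refl hu, ⟨hv, h⟩⟩
  · refine Set.eq_univ_of_forall fun x => ?_
    by_cases hx : x ∈ M
    · exact .inl (.inr hx)
    · by_cases hr : Reaches G Mᶜ u x
      exacts [.inl (.inl hr), .inr ⟨hx, hr⟩]
  · exact Set.disjoint_left.2 hL
  · exact Set.disjoint_left.2 fun x hx hx' => hx'.2 hx
  · exact Set.disjoint_left.2 fun x hx hx' => hx'.1 hx
  · exact fun x hx y hy hxy => hy.2 (hx.trans (.of_adj (hL x hx) hy.1 hxy))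

/-- In a (theta, prism)-free graph, no connected set of vertices whose neighbors in a pyramid lie
in the inner parts of its paths has neighbors in two of the paths. -/
theorem PyramidSeq.not_reaches_of_adj {G : SimpleGraph V} {a : V} {p : Fin 3 → ℕ → V}
    {L : Fin 3 → ℕ} (hth : ¬ ContainsTheta G) (hpr : ¬ ContainsPrism G)
    (h : PyramidSeq G a p L) {C : Set V} (hC : ∀ z ∈ C, ∀ l m, m ≤ L l → z ≠ p l m)
    (hb : ∀ z ∈ C, ∀ l m, m ≤ L l → G.Adj z (p l m) → 2 ≤ m ∧ m < L l)
    {i j : Fin 3} (hij : i ≠ j) {q q' : V} (hq : ∃ m ≤ L i, G.Adj q (p i m))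
    (hq' : ∃ m ≤ L j, G.Adj q' (p j m)) : ¬ Reaches G C q q' := by
  classical
  intro hr
  have hex : ∃ n, ∃ (i j : Fin 3) (q q' : V) (w : G.Walk q q'), i ≠ j ∧
      (∃ m ≤ L i, G.Adj q (p i m)) ∧ (∃ m ≤ L j, G.Adj q' (p j m)) ∧
      (∀ z ∈ w.support, z ∈ C) ∧ w.length = n := by
    obtain ⟨w, hw⟩ := hr
    exact ⟨_, i, j, q, q', w, hij, hq, hq', hw, rfl⟩
  clear hr hq hq' hij q q' i j
  obtain ⟨i, j, q, q', w, hij, hq, hq', hw, hlen⟩ := Nat.find_spec hex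
  have hmin {s t : Fin 3} {x y : V} (w' : G.Walk x y) (hst : s ≠ t)
      (hx : ∃ m ≤ L s, G.Adj x (p s m)) (hy : ∃ m ≤ L t, G.Adj y (p t m))
      (hw' : ∀ z ∈ w'.support, z ∈ C) : w.length ≤ w'.length :=
    hlen ▸ Nat.find_min' hex ⟨s, t, x, y, w', hst, hx, hy, hw', rfl⟩
  have hright (z : V) (hz : z ∈ w.support) (l : Fin 3) (hl : l ≠ j)
      (hzl : ∃ m ≤ L l, G.Adj z (p l m)) : z = q := by
    by_contra hne
    exact (Walk.length_dropUntil_lt_length hz hne).not_ge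
      (hmin (w.dropUntil z hz) hl hzl hq' fun t ht =>
        hw t (w.support_dropUntil_subset_support hz ht))
  have hleft (z : V) (hz : z ∈ w.support) (l : Fin 3) (hl : l ≠ i)
      (hzl : ∃ m ≤ L l, G.Adj z (p l m)) : z = q' := by
    by_contra hne
    exact (Walk.length_takeUntil_lt_length hz hne).not_ge
      (hmin (w.takeUntil z hz) hl.symm hq hzl fun t ht =>
        hw t (w.support_takeUntil_subset_support hz ht))
  by_cases hthird : ∃ z ∈ w.support, ∃ k, k ≠ i ∧ k ≠ j ∧ ∃ m ≤ L k, G.Adj z (p k m)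
  · obtain ⟨z, hz, k, hki, hkj, hzk⟩ := hthird
    obtain rfl := hright z hz k hkj hzk
    obtain rfl := hleft z hz k hki hzk
    refine hth (h.containsTheta_of_forall_adj (q := z) ?_ (hb z (hw z hz)) fun l => ?_)
    · exact fun he => hC z (hw z hz) 0 0 (Nat.zero_le _) (he.trans (h.zero 0).symm)
    · have : l = i ∨ l = j ∨ l = k := by omega
      rcases this with rfl | rfl | rfl
      exacts [hq, hq', hzk]
  · push Not at hthird
    have c : Connector G p L i j {z | z ∈ w.support} q q' :=
      { reaches := ⟨w, fun z hz => hz⟩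
        ne := fun z hz => hC z (hw z hz)
        bounds := fun z hz => hb z (hw z hz)
        eq_left := fun z hz m hm hzm => hright z hz i hij ⟨m, hm, hzm⟩
        eq_right := fun z hz m hm hzm => hleft z hz j hij.symm ⟨m, hm, hzm⟩
        other := hthird
        nbr_left := hq
        nbr_right := hq' }
    exact (c.containsTheta_or_containsPrism h hij).elim hth hpr

/-- breaking a pyramid. -/
theorem statement_7 {V : Type} [Fintype V] (G : SimpleGraph V)
    (hth : ¬ ContainsTheta G) (hpr : ¬ ContainsPrism G)
    (apx : V) (b : Fin 3 → V) (P : ∀ i, G.Walk apx (b i))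
    (hpyr : IsPyramid G apx b P)
    (u v : V) (i j : Fin 3) (hij : i ≠ j)
    (hu : u ∈ (P i).support) (hv : v ∈ (P j).support)
    (huZ : u ∉ ClosedNbhd G (ZPyramid G apx b P))
    (hvZ : v ∉ ClosedNbhd G (ZPyramid G apx b P)) :
    Separates G (ClosedNbhd G (ZPyramid G apx b P)) u v := by
  have hP := hpyr.pyramidSeq
  set M := ClosedNbhd G (ZPyramid G apx b P) with hM
  set C : Set V := {x | x ∉ M ∧ ∀ l, x ∉ (P l).support} with hCdef
  have hZM (z : V) (hz : z ∈ ZPyramid G apx b P) : z ∈ M := .inl hz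
  have hapx : apx ∈ M := hZM _ (.inl (.inl rfl))
  have hbM (l : Fin 3) : b l ∈ M := hZM _ (.inr ⟨l, rfl⟩)
  have hCne (z : V) (hz : z ∈ C) (l : Fin 3) (m : ℕ) (_ : m ≤ (P l).length) :
      z ≠ (P l).getVert m := fun he => hz.2 l (he ▸ (P l).getVert_mem_support m)
  have hCb (z : V) (hz : z ∈ C) (l : Fin 3) (m : ℕ) (hm : m ≤ (P l).length)
      (hzm : G.Adj z ((P l).getVert m)) : 2 ≤ m ∧ m < (P l).length := by
    have hnZ : (P l).getVert m ∉ ZPyramid G apx b P := fun hmem => hz.1 (.inr ⟨_, hmem, hzm⟩)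
    have h0 : m ≠ 0 := by
      rintro rfl
      exact hnZ (.inl (.inl (P l).getVert_zero))
    have h1 : m ≠ 1 := by
      rintro rfl
      refine hnZ (.inl (.inr ⟨⟨l, (P l).getVert_mem_support 1⟩, ?_⟩))
      simpa using (P l).adj_getVert_succ (i := 0) (by omega)
    have h2 : m ≠ (P l).length := by
      rintro rfl
      exact hnZ (.inr ⟨l, (P l).getVert_length.symm⟩)
    omega
  have hsep {s t : Fin 3} (hst : s ≠ t) {q q' : V} (hq : ∃ x ∈ (P s).support, G.Adj q x)
      (hq' : ∃ x ∈ (P t).support, G.Adj q' x) : ¬ Reaches G C q q' := by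
    refine hP.not_reaches_of_adj hth hpr hCne hCb hst ?_ ?_
    · obtain ⟨x, hx, hqx⟩ := hq
      obtain ⟨m, rfl, hm⟩ := Walk.mem_support_iff_exists_getVert.1 hx
      exact ⟨m, hm, hqx⟩
    · obtain ⟨x, hx, hqx⟩ := hq'
      obtain ⟨m, rfl, hm⟩ := Walk.mem_support_iff_exists_getVert.1 hx
      exact ⟨m, hm, hqx⟩
  obtain ⟨-, -, -, -, -, hdisj, hcross, -⟩ := hpyr
  refine separates_of_not_reaches huZ hvZ fun ⟨w, hw⟩ => ?_
  have hinv : ∀ {x y : V} (w : G.Walk x y), (∀ z ∈ w.support, z ∈ Mᶜ) →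
      (x ∈ (P i).support ∨ ∃ q, (∃ z ∈ (P i).support, G.Adj q z) ∧ Reaches G C q x) →
      (y ∈ (P i).support ∨ ∃ q, (∃ z ∈ (P i).support, G.Adj q z) ∧ Reaches G C q y) := by
    intro x y w
    induction w with
    | nil => exact fun _ hx => hx
    | @cons x y _ hxy w ih =>
      intro hw hx
      have hxM : x ∉ M := hw x (by simp)
      have hyM : y ∉ M := hw y (by simp)
      refine ih (fun z hz => hw z (by simp [hz])) ?_
      by_cases hyC : y ∈ C
      · rcases hx with hx | ⟨q, hq, hqx⟩
        · exact .inr ⟨y, ⟨x, hx, hxy.symm⟩, .refl hyC⟩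
        · exact .inr ⟨q, hq, hqx.trans (.of_adj hqx.symm.mem_left hyC hxy)⟩
      · obtain ⟨l, hl⟩ : ∃ l, y ∈ (P l).support := by
          by_contra! hall
          exact hyC ⟨hyM, hall⟩
        left
        by_cases hli : l = i
        · exact hli ▸ hl
        rcases hx with hx | ⟨q, hq, hqx⟩
        · have := hcross i l (Ne.symm hli) x hx y hl (fun he => hxM (he ▸ hapx))
            (fun he => hyM (he ▸ hapx)) hxy
          exact absurd (this.1 ▸ hbM i) hxM
        · exact absurd hqx (hsep (Ne.symm hli) hq ⟨y, hl, hxy⟩)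
  rcases hinv w hw (.inl hu) with hv' | ⟨q, -, hqv⟩
  · exact hvZ (hdisj i j hij v hv' hv ▸ hapx)
  · exact hqv.symm.mem_left.2 j hv

end Paper
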